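/- There exist absolute constants c, c', C, K > 0 such that the following holds for all sufficiently large n. Let Q° ∈ [0,1]^{n×n} be symmetric with zero diagonal, let d° := d(Q°) ≥ C, let R ≥ 1 satisfy Q°_ij ≤ R·d°/n for all i,j and R·d° ≥ 5, let η ∈ (0, 1/e) satisfy η·log(1/η)·R ≤ c, and let d̂ satisfy d°/2 ≤ d̂ ≤ 3d°/2. Then with probability at least 1 − n^{−c'} over a random graph A° drawn from G(n,Q°), the following holds: for every n-node graph A with dist(A, A°) ≤ η·n and every pair (Y, z) satisfying the feasibility constraints P1(A, 2η) with (Y·𝟙)_i ≤ 10·log(1/η)·R·d̂ for all i, one has |d(Y) − d°| ≤ K·( √(d°·log n/n) + η·log(1/η)·R·d° ). -/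

import Mathlib

open scoped BigOperators Classical

namespace EdgeDensity

/-- A graph on `n` nodes, identified with its Boolean adjacency function:
symmetric with no self-loops. -/
def IsGraph {n : ℕ} (A : Fin n → Fin n → Bool) : Prop :=
  (∀ i j, A i j = A j i) ∧ ∀ i, A i i = false

/-- The real adjacency matrix of a Boolean graph. -/
def adjMat {n : ℕ} (A : Fin n → Fin n → Bool) : Matrix (Fin n) (Fin n) ℝ :=
  Matrix.of fun i j => if A i j then 1 else 0

/-- `d(M) = (1/n) ∑_{i,j} M i j`, the average row sum. -/
noncomputable def dbar {n : ℕ} (M : Matrix (Fin n) (Fin n) ℝ) : ℝ :=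
  (∑ i, ∑ j, M i j) / n

/-- `(M 𝟙)_i = ∑_j M i j`, the `i`-th row sum (degree of node `i`). -/
def rowSum {n : ℕ} (M : Matrix (Fin n) (Fin n) ℝ) (i : Fin n) : ℝ := ∑ j, M i j

/-- The probability that the inhomogeneous random graph `G(n,Q)` equals the
given graph `A`: each edge `{i,j}` with `i < j` is present independently with
probability `Q i j`. -/
noncomputable def erWeight {n : ℕ} (Q : Matrix (Fin n) (Fin n) ℝ)
    (A : Fin n → Fin n → Bool) : ℝ :=
  ∏ i, ∏ j ∈ Finset.univ.filter (fun j => i < j),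
    (if A i j then Q i j else 1 - Q i j)

/-- Probability of the event `E` under the inhomogeneous random graph `G(n,Q)`. -/
noncomputable def erProb {n : ℕ} (Q : Matrix (Fin n) (Fin n) ℝ)
    (E : (Fin n → Fin n → Bool) → Prop) : ℝ :=
  ∑ A ∈ Finset.univ.filter (fun A => IsGraph A ∧ E A), erWeight Q A

/-- Node distance between two graphs: the minimum cardinality of a set `S` of
nodes such that the two adjacency matrices agree on all entries `(i,j)` with
`i ∉ S` and `j ∉ S`. -/
noncomputable def nodeDist {n : ℕ} (A B : Fin n → Fin n → Bool) : ℕ :=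
  sInf {k | ∃ S : Finset (Fin n), S.card = k ∧
    ∀ i j, i ∉ S → j ∉ S → A i j = B i j}

/-- The feasibility constraints `P1(A, γ)` on a pair `(Y, z)`. -/
def P1 {n : ℕ} (A : Matrix (Fin n) (Fin n) ℝ) (γ : ℝ)
    (Y : Matrix (Fin n) (Fin n) ℝ) (z : Fin n → ℝ) : Prop :=
  (∀ i, z i = 0 ∨ z i = 1) ∧
  ((1 - γ) * n ≤ ∑ i, z i) ∧
  (∀ i j, Y i j = Y j i) ∧
  (∀ i j, 0 ≤ Y i j ∧ Y i j ≤ 1) ∧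
  (∀ i j, Y i j * z i * z j = A i j * z i * z j)

/-- The binomial probability mass function `Bin(n,p)` at `k`. -/
noncomputable def binomPMF (n : ℕ) (p : ℝ) (k : ℕ) : ℝ :=
  (n.choose k : ℝ) * p ^ k * (1 - p) ^ (n - k)

/-- Total variation distance between `Bin(n,p)` and `Bin(n,q)`. -/
noncomputable def binomTV (n : ℕ) (p q : ℝ) : ℝ :=
  (∑ k ∈ Finset.range (n + 1), |binomPMF n p k - binomPMF n q k|) / 2

/-- The spectral norm (largest singular value) of a real square matrix. -/
noncomputable def specNorm {n : ℕ} (M : Matrix (Fin n) (Fin n) ℝ) : ℝ :=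
  ‖LinearMap.toContinuousLinearMap (Matrix.toEuclideanLin M)‖

/-- A randomized algorithm on `n`-node graphs is `ε`-differentially
node-private. -/
def IsNodeDP {n : ℕ} (ε : ℝ)
    (𝒜 : (Fin n → Fin n → Bool) → MeasureTheory.Measure ℝ) : Prop :=
  ∀ G G', IsGraph G → IsGraph G' → nodeDist G G' ≤ 1 →
    ∀ S : Set ℝ, MeasurableSet S →
      𝒜 G S ≤ ENNReal.ofReal (Real.exp ε) * 𝒜 G' S

/-- `Pr_{G ~ G(n,Q), 𝒜}[𝒜(G) ∈ S]`. -/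
noncomputable def algProb {n : ℕ} (Q : Matrix (Fin n) (Fin n) ℝ)
    (𝒜 : (Fin n → Fin n → Bool) → MeasureTheory.Measure ℝ) (S : Set ℝ) : ℝ :=
  ∑ A ∈ Finset.univ.filter (fun A => IsGraph A), erWeight Q A * (𝒜 A S).toReal


lemma erWeight_nonneg {n : ℕ} {Q : Matrix (Fin n) (Fin n) ℝ}
    (hQ : ∀ i j, 0 ≤ Q i j ∧ Q i j ≤ 1) (A : Fin n → Fin n → Bool) : 0 ≤ erWeight Q A := by
  unfold erWeight
  refine Finset.prod_nonneg fun i _ => Finset.prod_nonneg fun j _ => ?_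
  split_ifs
  · exact (hQ i j).1
  · linarith [(hQ i j).2]

/-- The graph whose edges `i < j` are prescribed by `f`. -/
def graphOfUpper {n : ℕ} (f : {p : Fin n × Fin n // p.1 < p.2} → Bool) :
    Fin n → Fin n → Bool := fun i j =>
  if h : i < j then f ⟨(i, j), h⟩ else if h : j < i then f ⟨(j, i), h⟩ else false

lemma isGraph_graphOfUpper {n : ℕ} (f : {p : Fin n × Fin n // p.1 < p.2} → Bool) :
    IsGraph (graphOfUpper f) := by
  refine ⟨fun i j => ?_, fun i => by simp [graphOfUpper]⟩
  rcases lt_trichotomy i j with h | h | h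
  · simp [graphOfUpper, h, h.not_gt]
  · simp [h]
  · simp [graphOfUpper, h, h.not_gt]

lemma prod_upper {n : ℕ} (F : Fin n → Fin n → ℝ) :
    ∏ i, ∏ j ∈ Finset.univ.filter (fun j => i < j), F i j =
      ∏ p : {p : Fin n × Fin n // p.1 < p.2}, F p.1.1 p.1.2 := by
  simp_rw [Finset.prod_filter]
  rw [← Fintype.prod_prod_type' (fun i j => if i < j then F i j else 1),
    ← Finset.prod_filter]
  exact Finset.prod_subtype _ (by simp) (fun p : Fin n × Fin n => F p.1 p.2)

/-- Expectations of functions that factorize over the edges factorize. -/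
lemma sum_isGraph_prod {n : ℕ} (F : Fin n → Fin n → Bool → ℝ) :
    ∑ A ∈ Finset.univ.filter (fun A : Fin n → Fin n → Bool => IsGraph A),
      ∏ i, ∏ j ∈ Finset.univ.filter (fun j => i < j), F i j (A i j) =
    ∏ i, ∏ j ∈ Finset.univ.filter (fun j => i < j), (F i j true + F i j false) := by
  rw [prod_upper (fun i j => F i j true + F i j false)]
  have h := Finset.prod_univ_sum (fun _ : {p : Fin n × Fin n // p.1 < p.2} =>
    (Finset.univ : Finset Bool)) (fun p b => F p.1.1 p.1.2 b)
  simp only [Fintype.sum_bool, Fintype.piFinset_univ] at h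
  rw [h]
  simp_rw [fun A : Fin n → Fin n → Bool => prod_upper (fun i j => F i j (A i j))]
  refine Finset.sum_bij' (fun A _ p => A p.1.1 p.1.2) (fun f _ => graphOfUpper f) ?_ ?_ ?_ ?_ ?_
  · simp
  · simp [isGraph_graphOfUpper]
  · intro A hA
    obtain ⟨hs, hd⟩ := (Finset.mem_filter.1 hA).2
    funext i j
    rcases lt_trichotomy i j with h | h | h
    · simp [graphOfUpper, h]
    · simp [graphOfUpper, h, hd]
    · simp [graphOfUpper, h, h.not_gt, hs i j]
  · intro f _
    funext p
    simp [graphOfUpper, p.2]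
  · simp

lemma sum_erWeight {n : ℕ} (Q : Matrix (Fin n) (Fin n) ℝ) :
    ∑ A ∈ Finset.univ.filter (fun A : Fin n → Fin n → Bool => IsGraph A), erWeight Q A = 1 := by
  have := sum_isGraph_prod (fun i j b => if b then Q i j else 1 - Q i j)
  simpa [erWeight] using this

/-- Markov's inequality for the complement of `E`. -/
lemma one_sub_sum_le_erProb {n : ℕ} {Q : Matrix (Fin n) (Fin n) ℝ}
    (hQ : ∀ i j, 0 ≤ Q i j ∧ Q i j ≤ 1) (E : (Fin n → Fin n → Bool) → Prop)
    (g : (Fin n → Fin n → Bool) → ℝ) (hg0 : ∀ A, 0 ≤ g A)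
    (hg1 : ∀ A, IsGraph A → ¬ E A → 1 ≤ g A) :
    1 - ∑ A ∈ Finset.univ.filter (fun A : Fin n → Fin n → Bool => IsGraph A),
      erWeight Q A * g A ≤ erProb Q E := by
  rw [← sum_erWeight Q, ← Finset.sum_sub_distrib, erProb, ← Finset.filter_filter,
    Finset.sum_filter (s := Finset.univ.filter _)]
  refine Finset.sum_le_sum fun A hA => ?_
  have hw := erWeight_nonneg hQ A
  split_ifs with h
  · nlinarith [mul_nonneg hw (hg0 A)]
  · nlinarith [hg1 A (Finset.mem_filter.1 hA).2 h]

lemma sum_upper {n : ℕ} (M : Fin n → Fin n → ℝ) (hM : ∀ i j, M i j = M j i)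
    (hd : ∀ i, M i i = 0) (u : Fin n → ℝ) :
    ∑ i, u i * ∑ j, M i j =
      ∑ i, ∑ j ∈ Finset.univ.filter (fun j => i < j), M i j * (u i + u j) := by
  simp_rw [Finset.sum_filter, Finset.mul_sum]
  have h1 : ∀ i j, u i * M i j =
      (if i < j then M i j * u i else 0) + (if j < i then M j i * u i else 0) := by
    intro i j
    rcases lt_trichotomy i j with h | h | h
    · simp [h, h.not_gt, mul_comm]
    · simp [h, hd]
    · simp [h, h.not_gt, hM i j, mul_comm]
  simp_rw [h1, Finset.sum_add_distrib]
  rw [Finset.sum_comm (f := fun i j => if j < i then M j i * u i else 0)]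
  rw [← Finset.sum_add_distrib]
  refine Finset.sum_congr rfl fun i _ => ?_
  rw [← Finset.sum_add_distrib]
  refine Finset.sum_congr rfl fun j _ => ?_
  split_ifs <;> ring

/-- Exponential moments of weighted degree sums. -/
lemma sum_erWeight_mul_exp_le {n : ℕ} {Q : Matrix (Fin n) (Fin n) ℝ}
    (hsymm : ∀ i j, Q i j = Q j i) (hdiag : ∀ i, Q i i = 0)
    (hQ : ∀ i j, 0 ≤ Q i j ∧ Q i j ≤ 1) (u : Fin n → ℝ) (κ : ℝ)
    (hκ : ∀ i j, Real.exp (u i + u j) - 1 ≤ κ * (u i + u j)) :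
    ∑ A ∈ Finset.univ.filter (fun A : Fin n → Fin n → Bool => IsGraph A),
      erWeight Q A * Real.exp (∑ i, u i * rowSum (adjMat A) i) ≤
    Real.exp (κ * ∑ i, u i * rowSum Q i) := by
  have h1 : ∀ A ∈ Finset.univ.filter (fun A : Fin n → Fin n → Bool => IsGraph A),
      erWeight Q A * Real.exp (∑ i, u i * rowSum (adjMat A) i) =
      ∏ i, ∏ j ∈ Finset.univ.filter (fun j => i < j),
        (fun i j (b : Bool) => if b then Q i j * Real.exp (u i + u j) else 1 - Q i j)
          i j (A i j) := by
    intro A hA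
    obtain ⟨hs, hd⟩ := (Finset.mem_filter.1 hA).2
    simp only [rowSum]
    rw [sum_upper (adjMat A) (by simp [adjMat, hs]) (by simp [adjMat, hd]) u]
    simp_rw [Real.exp_sum, erWeight, ← Finset.prod_mul_distrib]
    refine Finset.prod_congr rfl fun i _ => Finset.prod_congr rfl fun j _ => ?_
    by_cases h : A i j <;> simp [adjMat, h]
  rw [Finset.sum_congr rfl h1, sum_isGraph_prod
    (fun i j b => if b then Q i j * Real.exp (u i + u j) else 1 - Q i j)]
  simp only [rowSum]
  rw [sum_upper Q hsymm hdiag u]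
  simp_rw [Finset.mul_sum, Real.exp_sum]
  have h2 : ∀ i j, 0 ≤ Q i j * Real.exp (u i + u j) + (1 - Q i j) := fun i j =>
    add_nonneg (mul_nonneg (hQ i j).1 (Real.exp_pos _).le) (by linarith [(hQ i j).2])
  refine Finset.prod_le_prod (fun i _ => Finset.prod_nonneg fun j _ => by simpa using h2 i j)
    fun i _ => Finset.prod_le_prod (fun j _ => by simpa using h2 i j) fun j _ => ?_
  have h3 := Real.add_one_le_exp (κ * (Q i j * (u i + u j)))
  have h4 := mul_le_mul_of_nonneg_left (hκ i j) (hQ i j).1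
  simp only [if_true, Bool.false_eq_true, if_false]
  nlinarith

/-- The number of small subsets, weighted by `exp`. -/
lemma card_filter_card_le {n : ℕ} {η m : ℝ} (h0 : 0 < η) (h1 : η ≤ 1) :
    ((Finset.univ.filter (fun T : Finset (Fin n) => (T.card : ℝ) ≤ m)).card : ℝ) ≤
      Real.exp (η * n + m * Real.log (1 / η)) := by
  have hL : 0 ≤ Real.log (1 / η) := Real.log_nonneg (by rw [le_div_iff₀ h0]; linarith)
  have hsum : ∑ T : Finset (Fin n), η ^ T.card = (1 + η) ^ n := by
    have := Finset.prod_one_add (f := fun _ : Fin n => η) (s := Finset.univ)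
    simpa using this.symm
  calc ((Finset.univ.filter (fun T : Finset (Fin n) => (T.card : ℝ) ≤ m)).card : ℝ)
      = ∑ T ∈ Finset.univ.filter (fun T : Finset (Fin n) => (T.card : ℝ) ≤ m), (1 : ℝ) := by simp
    _ ≤ ∑ T ∈ Finset.univ.filter (fun T : Finset (Fin n) => (T.card : ℝ) ≤ m),
          η ^ T.card * Real.exp (m * Real.log (1 / η)) := by
        refine Finset.sum_le_sum fun T hT => ?_
        have hT' := (Finset.mem_filter.1 hT).2
        have : η ^ T.card = Real.exp (-(T.card * Real.log (1 / η))) := by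
          rw [one_div, Real.log_inv, mul_neg, neg_neg, Real.exp_nat_mul, Real.exp_log h0]
        rw [this, ← Real.exp_add]
        apply Real.one_le_exp
        nlinarith
    _ ≤ ∑ T : Finset (Fin n), η ^ T.card * Real.exp (m * Real.log (1 / η)) :=
        Finset.sum_le_sum_of_subset_of_nonneg (Finset.filter_subset _ _)
          fun T _ _ => by positivity
    _ = (1 + η) ^ n * Real.exp (m * Real.log (1 / η)) := by rw [← Finset.sum_mul, hsum]
    _ ≤ Real.exp η ^ n * Real.exp (m * Real.log (1 / η)) := by
        gcongr
        linarith [Real.add_one_le_exp η]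
    _ = _ := by rw [← Real.exp_nat_mul, ← Real.exp_add, mul_comm (n : ℝ)]

/-- Two symmetric nonnegative matrices agreeing off `T` have close entry sums. -/
lemma abs_sum_sub_sum_le {n : ℕ} (Y B : Matrix (Fin n) (Fin n) ℝ) (T : Finset (Fin n))
    (hY : ∀ i j, Y i j = Y j i) (hB : ∀ i j, B i j = B j i)
    (hY0 : ∀ i j, 0 ≤ Y i j) (hB0 : ∀ i j, 0 ≤ B i j)
    (h : ∀ i j, i ∉ T → j ∉ T → Y i j = B i j) :
    |∑ i, rowSum Y i - ∑ i, rowSum B i| ≤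
      2 * (∑ i ∈ T, rowSum Y i + ∑ i ∈ T, rowSum B i) := by
  have key : ∀ i j, |Y i j - B i j| ≤
      (if i ∈ T then Y i j + B i j else 0) + (if j ∈ T then Y j i + B j i else 0) := by
    intro i j
    have h1 : |Y i j - B i j| ≤ Y i j + B i j :=
      abs_le.2 ⟨by linarith [hY0 i j, hB0 i j], by linarith [hY0 i j, hB0 i j]⟩
    have h2 := add_nonneg (hY0 i j) (hB0 i j)
    rw [← hY i j, ← hB i j]
    split_ifs with hi hj hj
    · linarith
    · linarith
    · linarith
    · simp [h i j hi hj]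
  have hsum : ∑ i, ∑ j, (if i ∈ T then Y i j + B i j else 0) =
      ∑ i ∈ T, rowSum Y i + ∑ i ∈ T, rowSum B i := by
    have hrow : ∀ i, ∑ j, (if i ∈ T then Y i j + B i j else 0) =
        if i ∈ T then rowSum Y i + rowSum B i else 0 := by
      intro i
      split_ifs <;> simp [rowSum, Finset.sum_add_distrib]
    simp_rw [hrow, Finset.sum_ite_mem, Finset.univ_inter, Finset.sum_add_distrib]
  calc |∑ i, rowSum Y i - ∑ i, rowSum B i| = |∑ i, ∑ j, (Y i j - B i j)| := by
        simp [rowSum, Finset.sum_sub_distrib]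
    _ ≤ ∑ i, ∑ j, |Y i j - B i j| := (Finset.abs_sum_le_sum_abs _ _).trans
        (Finset.sum_le_sum fun i _ => Finset.abs_sum_le_sum_abs _ _)
    _ ≤ ∑ i, ∑ j, ((if i ∈ T then Y i j + B i j else 0) +
          (if j ∈ T then Y j i + B j i else 0)) :=
        Finset.sum_le_sum fun i _ => Finset.sum_le_sum fun j _ => key i j
    _ = _ := by
        simp_rw [Finset.sum_add_distrib]
        rw [Finset.sum_comm (f := fun i j => if j ∈ T then Y j i + B j i else 0), hsum]
        ring

lemma exists_nodeDist {n : ℕ} (A B : Fin n → Fin n → Bool) :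
    ∃ S : Finset (Fin n), S.card = nodeDist A B ∧ ∀ i j, i ∉ S → j ∉ S → A i j = B i j :=
  Nat.sInf_mem (s := {k | ∃ S : Finset (Fin n), S.card = k ∧
    ∀ i j, i ∉ S → j ∉ S → A i j = B i j}) ⟨_, Finset.univ, rfl, by simp⟩

/-- A feasible matrix agrees with the uncorrupted graph off a small set of nodes. -/
lemma exists_agreement_set {n : ℕ} {A A₀ : Fin n → Fin n → Bool} {η : ℝ}
    (hdist : (nodeDist A A₀ : ℝ) ≤ η * n) {Y : Matrix (Fin n) (Fin n) ℝ} {z : Fin n → ℝ}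
    (hP : P1 (adjMat A) (2 * η) Y z) :
    ∃ T : Finset (Fin n), (T.card : ℝ) ≤ 3 * η * n ∧
      ∀ i j, i ∉ T → j ∉ T → Y i j = adjMat A₀ i j := by
  obtain ⟨hz, hzs, -, -, hYA⟩ := hP
  obtain ⟨S, hS, hSA⟩ := exists_nodeDist A A₀
  refine ⟨S ∪ Finset.univ.filter (fun i => z i = 0), ?_, fun i j hi hj => ?_⟩
  · have h1 : ∑ i, z i = n - ((Finset.univ.filter (fun i => z i = 0)).card : ℝ) := by
      have h2 : ∀ i, z i = 1 - if z i = 0 then 1 else 0 := by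
        intro i
        rcases hz i with h | h <;> simp [h]
      rw [Finset.sum_congr rfl fun i _ => h2 i, Finset.sum_sub_distrib, Finset.sum_boole]
      simp
    have h3 : ((S ∪ Finset.univ.filter (fun i => z i = 0)).card : ℝ) ≤
        S.card + (Finset.univ.filter (fun i => z i = 0)).card := by
      exact_mod_cast Finset.card_union_le _ _
    rw [hS] at h3
    linarith
  · simp only [Finset.mem_union, Finset.mem_filter, Finset.mem_univ, true_and, not_or] at hi hj
    have h1 := hYA i j
    rw [(hz i).resolve_left hi.2, (hz j).resolve_left hj.2] at h1
    simp only [mul_one] at h1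
    rw [h1]
    simp [adjMat, hSA i j hi.1 hj.1]

lemma sum_erWeight_mul_exp_total_le {n : ℕ} {Q : Matrix (Fin n) (Fin n) ℝ}
    (hsymm : ∀ i j, Q i j = Q j i) (hdiag : ∀ i, Q i i = 0)
    (hQ : ∀ i j, 0 ≤ Q i j ∧ Q i j ≤ 1) {v : ℝ} (hv : |v| ≤ 1 / 2) (a : ℝ) :
    ∑ A ∈ Finset.univ.filter (fun A : Fin n → Fin n → Bool => IsGraph A),
      erWeight Q A *
        Real.exp (v * (∑ i, rowSum (adjMat A) i - ∑ i, rowSum Q i) - a) ≤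
    Real.exp (2 * v ^ 2 * ∑ i, rowSum Q i - a) := by
  have h := sum_erWeight_mul_exp_le hsymm hdiag hQ (fun _ => v) (1 + 2 * v) (fun i j => by
    have h1 : |v + v| ≤ 1 := by rw [← two_mul, abs_mul, abs_two]; linarith
    have h2 := (abs_le.1 (Real.abs_exp_sub_one_sub_id_le h1)).2
    nlinarith)
  simp only [← Finset.mul_sum] at h
  have h3 : ∀ A : Fin n → Fin n → Bool, erWeight Q A *
      Real.exp (v * (∑ i, rowSum (adjMat A) i - ∑ i, rowSum Q i) - a) =
      erWeight Q A * Real.exp (v * ∑ i, rowSum (adjMat A) i) *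
        Real.exp (-(v * ∑ i, rowSum Q i) - a) := by
    intro A
    rw [mul_assoc, ← Real.exp_add]
    ring_nf
  rw [Finset.sum_congr rfl fun A _ => h3 A, ← Finset.sum_mul]
  refine (mul_le_mul_of_nonneg_right h (Real.exp_pos _).le).trans_eq ?_
  rw [← Real.exp_add]
  ring_nf

lemma sum_erWeight_mul_exp_subset_le {n : ℕ} {Q : Matrix (Fin n) (Fin n) ℝ}
    (hsymm : ∀ i j, Q i j = Q j i) (hdiag : ∀ i, Q i i = 0)
    (hQ : ∀ i j, 0 ≤ Q i j ∧ Q i j ≤ 1) (T : Finset (Fin n)) (a : ℝ) :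
    ∑ A ∈ Finset.univ.filter (fun A : Fin n → Fin n → Bool => IsGraph A),
      erWeight Q A * Real.exp (∑ i ∈ T, rowSum (adjMat A) i - a) ≤
    Real.exp (4 * ∑ i ∈ T, rowSum Q i - a) := by
  have he1 : Real.exp 1 < 2.7182818286 := Real.exp_one_lt_d9
  have he2 : Real.exp (1 + 1) ≤ 9 := by
    rw [Real.exp_add]
    nlinarith [Real.exp_pos 1]
  have h := sum_erWeight_mul_exp_le hsymm hdiag hQ (fun i => if i ∈ T then 1 else 0) 4
    (fun i j => by
      split_ifs <;> norm_num at he2 ⊢ <;> linarith)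
  simp only [ite_mul, one_mul, zero_mul, Finset.sum_ite_mem, Finset.univ_inter] at h
  simp_rw [sub_eq_add_neg, Real.exp_add, ← mul_assoc]
  rw [← Finset.sum_mul]
  exact mul_le_mul_of_nonneg_right h (Real.exp_pos _).le

lemma erProb_mono {n : ℕ} {Q : Matrix (Fin n) (Fin n) ℝ}
    (hQ : ∀ i j, 0 ≤ Q i j ∧ Q i j ≤ 1) {E F : (Fin n → Fin n → Bool) → Prop}
    (h : ∀ A, IsGraph A → E A → F A) : erProb Q E ≤ erProb Q F := by
  refine Finset.sum_le_sum_of_subset_of_nonneg (fun A hA => ?_)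
    fun A _ _ => erWeight_nonneg hQ A
  obtain ⟨h1, h2⟩ := (Finset.mem_filter.1 hA).2
  exact Finset.mem_filter.2 ⟨Finset.mem_univ _, h1, h A h1 h2⟩

lemma log_le_of_one_le_three_mul {n : ℕ} {η : ℝ} (hη : 0 < η) (hη1 : η < 1 / Real.exp 1)
    (h : 1 ≤ 3 * η * n) : Real.log n ≤ 3 * (η * Real.log (1 / η) * n) := by
  have hn : (0 : ℝ) < n := by
    rcases (Nat.cast_nonneg n : (0 : ℝ) ≤ n).eq_or_lt with h0 | h0
    · rw [← h0] at h
      linarith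
    · exact h0
  have h1 : Real.exp 1 ≤ 1 / η := by
    rw [le_div_iff₀ hη]
    rw [lt_div_iff₀ (Real.exp_pos 1)] at hη1
    linarith
  have h2 : 1 / η ≤ 3 * n := by
    rw [div_le_iff₀ hη]
    linarith
  have h3 := Real.log_div_self_antitoneOn (Set.mem_ofPred.2 h1) (Set.mem_ofPred.2 (h1.trans h2)) h2
  simp only [div_div_eq_mul_div, div_one] at h3
  rw [div_le_iff₀ (by positivity)] at h3
  have h4 : Real.log n ≤ Real.log (3 * n) := Real.log_le_log hn (by linarith)
  linarith

/-- With high probability, the number of edges concentrates and small sets of nodes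
have small total degree. -/
lemma le_erProb_regular {n : ℕ} (hn : 16 ≤ n) {Q : Matrix (Fin n) (Fin n) ℝ} {R η : ℝ}
    (hsymm : ∀ i j, Q i j = Q j i) (hdiag : ∀ i, Q i i = 0)
    (hQ : ∀ i j, 0 ≤ Q i j ∧ Q i j ≤ 1) (hd : 1 ≤ dbar Q)
    (hR : ∀ i j, Q i j ≤ R * dbar Q / n) (hRd : 5 ≤ R * dbar Q)
    (hη : 0 < η) (hη1 : η < 1 / Real.exp 1) :
    1 - (n : ℝ)⁻¹ ≤ erProb Q (fun A =>
      |∑ i, rowSum (adjMat A) i - ∑ i, rowSum Q i| ≤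
        4 * Real.sqrt (n * dbar Q * Real.log n) ∧
      ∀ T : Finset (Fin n), (T.card : ℝ) ≤ 3 * η * n →
        ∑ i ∈ T, rowSum (adjMat A) i ≤ 14 * (η * Real.log (1 / η) * n * (R * dbar Q))) := by
  have hn' : (16 : ℝ) ≤ n := by exact_mod_cast hn
  have hn0 : (0 : ℝ) < n := by linarith
  have hS : ∑ i, rowSum Q i = n * dbar Q := by
    simp only [dbar, rowSum]
    field_simp
  set S : ℝ := n * dbar Q with hSdef
  have hSn : (n : ℝ) ≤ S := by nlinarith
  have hS0 : 0 < S := by linarith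
  set ℓ : ℝ := Real.log n with hℓ
  have hℓ0 : 0 ≤ ℓ := Real.log_nonneg (by linarith)
  have hℓn : ℓ ≤ n := (Real.log_le_sub_one_of_pos hn0).trans (by linarith)
  set L : ℝ := Real.log (1 / η) with hL
  have hL1 : 1 ≤ L := by
    rw [hL, Real.le_log_iff_exp_le (by positivity), le_div_iff₀ hη]
    rw [lt_div_iff₀ (Real.exp_pos 1)] at hη1
    linarith
  have hη1' : η ≤ 1 := hη1.le.trans
    (by rw [div_le_one (Real.exp_pos 1)]; exact Real.one_le_exp zero_le_one)
  set t : ℝ := 14 * (η * L * n * (R * dbar Q)) with ht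
  have ht0 : 0 ≤ t := by positivity
  set v : ℝ := Real.sqrt (ℓ / S) / 2 with hv
  have hv0 : 0 ≤ v := by positivity
  have hv1 : |v| ≤ 1 / 2 := by
    rw [abs_of_nonneg hv0, hv]
    have : Real.sqrt (ℓ / S) ≤ 1 := by
      rw [Real.sqrt_le_one, div_le_one hS0]
      linarith
    linarith
  have hv2 : 2 * v ^ 2 * S = ℓ / 2 := by
    rw [hv, div_pow, Real.sq_sqrt (by positivity)]
    field_simp
  have hvs : v * (4 * Real.sqrt (S * ℓ)) = 2 * ℓ := by
    have : Real.sqrt (ℓ / S) * Real.sqrt (S * ℓ) = ℓ := by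
      rw [← Real.sqrt_mul (by positivity), show ℓ / S * (S * ℓ) = ℓ ^ 2 by field_simp,
        Real.sqrt_sq hℓ0]
    rw [hv]
    linarith
  set 𝒯 : Finset (Finset (Fin n)) := if 1 ≤ 3 * η * n then
    Finset.univ.filter (fun T : Finset (Fin n) => (T.card : ℝ) ≤ 3 * η * n) else ∅ with h𝒯
  let Δ : (Fin n → Fin n → Bool) → ℝ := fun A => ∑ i, rowSum (adjMat A) i - ∑ i, rowSum Q i
  refine le_trans ?_ (one_sub_sum_le_erProb hQ _
    (fun A => Real.exp (v * Δ A - 2 * ℓ) + Real.exp (-v * Δ A - 2 * ℓ) +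
      ∑ T ∈ 𝒯, Real.exp (∑ i ∈ T, rowSum (adjMat A) i - t)) (fun A => by positivity) ?_)
  · have hsub : ∑ T ∈ 𝒯, Real.exp (4 * ∑ i ∈ T, rowSum Q i - t) ≤ Real.exp (-(2 * ℓ)) := by
      by_cases hbig : 1 ≤ 3 * η * n
      · rw [h𝒯, if_pos hbig]
        have hT : ∀ T ∈ Finset.univ.filter
            (fun T : Finset (Fin n) => (T.card : ℝ) ≤ 3 * η * n),
            Real.exp (4 * ∑ i ∈ T, rowSum Q i - t) ≤
              Real.exp (12 * η * n * (R * dbar Q) - t) := by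
          intro T hT
          have hTc := (Finset.mem_filter.1 hT).2
          have hrow : ∀ i, rowSum Q i ≤ R * dbar Q := by
            intro i
            refine (Finset.sum_le_sum fun j _ => hR i j).trans_eq ?_
            simp only [Finset.sum_const, Finset.card_univ, Fintype.card_fin, nsmul_eq_mul]
            field_simp
          have hs : ∑ i ∈ T, rowSum Q i ≤ T.card * (R * dbar Q) := by
            refine (Finset.sum_le_sum fun i _ => hrow i).trans_eq ?_
            simp
          apply Real.exp_le_exp.2
          nlinarith
        refine (Finset.sum_le_sum hT).trans ?_
        rw [Finset.sum_const, nsmul_eq_mul]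
        refine (mul_le_mul_of_nonneg_right (card_filter_card_le hη hη1')
          (Real.exp_pos _).le).trans ?_
        rw [← Real.exp_add, ← hL]
        apply Real.exp_le_exp.2
        have hlog := log_le_of_one_le_three_mul hη hη1 hbig
        rw [← hL, ← hℓ] at hlog
        have hηn : 0 < η * n := by positivity
        have h1 : η * n ≤ η * L * n := by nlinarith
        have h2 : η * n * (R * dbar Q) ≤ η * L * n * (R * dbar Q) :=
          mul_le_mul_of_nonneg_right h1 (by linarith)
        have h3 : η * L * n * 5 ≤ η * L * n * (R * dbar Q) :=
          mul_le_mul_of_nonneg_left hRd (by positivity)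
        linarith
      · rw [h𝒯, if_neg hbig, Finset.sum_empty]
        positivity
    have hexp : ∑ A ∈ Finset.univ.filter (fun A : Fin n → Fin n → Bool => IsGraph A),
        erWeight Q A * (Real.exp (v * Δ A - 2 * ℓ) + Real.exp (-v * Δ A - 2 * ℓ) +
          ∑ T ∈ 𝒯, Real.exp (∑ i ∈ T, rowSum (adjMat A) i - t)) ≤
        Real.exp (2 * v ^ 2 * S - 2 * ℓ) + Real.exp (2 * v ^ 2 * S - 2 * ℓ) +
          Real.exp (-(2 * ℓ)) := by
      simp_rw [mul_add, Finset.mul_sum, Finset.sum_add_distrib]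
      rw [Finset.sum_comm]
      have h1 := sum_erWeight_mul_exp_total_le hsymm hdiag hQ hv1 (2 * ℓ)
      have h2 := sum_erWeight_mul_exp_total_le hsymm hdiag hQ
        (v := -v) (by rwa [abs_neg]) (2 * ℓ)
      rw [hS] at h1 h2
      rw [neg_sq] at h2
      have h3 := (Finset.sum_le_sum fun T (_ : T ∈ 𝒯) =>
        sum_erWeight_mul_exp_subset_le hsymm hdiag hQ T t).trans hsub
      simp only [Δ, hS]
      exact add_le_add (add_le_add h1 h2) h3
    refine sub_le_sub_left (hexp.trans ?_) _
    set y := Real.exp (-(ℓ / 2)) with hy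
    have hy0 : 0 < y := Real.exp_pos _
    have hy2 : (n : ℝ)⁻¹ = y ^ 2 := by
      rw [hy, ← Real.exp_nat_mul, ← Real.exp_log (inv_pos.2 hn0), Real.log_inv]
      congr 1
      push_cast
      ring
    have hy3 : Real.exp (2 * v ^ 2 * S - 2 * ℓ) = y ^ 3 := by
      rw [hv2, hy, ← Real.exp_nat_mul]
      congr 1
      push_cast
      ring
    have hy4 : Real.exp (-(2 * ℓ)) = y ^ 4 := by
      rw [hy, ← Real.exp_nat_mul]
      congr 1
      push_cast
      ring
    have hy5 : y ≤ 1 / 4 := by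
      have : y ^ 2 ≤ (1 / 4) ^ 2 := by
        rw [← hy2, inv_le_comm₀ hn0 (by norm_num)]
        norm_num
        exact hn
      exact le_of_sq_le_sq this (by norm_num)
    rw [hy3, hy4, hy2]
    nlinarith [mul_pos hy0 hy0, mul_nonneg (mul_pos hy0 hy0).le (sub_nonneg.2 hy5),
      mul_nonneg (mul_pos hy0 hy0).le (mul_nonneg hy0.le (sub_nonneg.2 hy5))]
  · intro A _ hE
    have hp1 := Real.exp_pos (v * Δ A - 2 * ℓ)
    have hp2 := Real.exp_pos (-v * Δ A - 2 * ℓ)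
    have hp3 : 0 ≤ ∑ T ∈ 𝒯, Real.exp (∑ i ∈ T, rowSum (adjMat A) i - t) := by positivity
    rcases not_and_or.1 hE with hE | hE
    · rcases lt_abs.1 (not_le.1 hE) with h | h
      · have : 1 ≤ Real.exp (v * Δ A - 2 * ℓ) := Real.one_le_exp (by
          have := mul_le_mul_of_nonneg_left h.le hv0
          simp only [Δ]
          linarith)
        linarith
      · have : 1 ≤ Real.exp (-v * Δ A - 2 * ℓ) := Real.one_le_exp (by
          have := mul_le_mul_of_nonneg_left h.le hv0
          simp only [Δ]
          linarith)
        linarith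
    · push Not at hE
      obtain ⟨T, hTc, hT⟩ := hE
      have hmem : T ∈ 𝒯 := by
        by_cases hbig : 1 ≤ 3 * η * n
        · rw [h𝒯, if_pos hbig]
          exact Finset.mem_filter.2 ⟨Finset.mem_univ _, hTc⟩
        · have h0 : T.card < 1 := by exact_mod_cast hTc.trans_lt (not_le.1 hbig)
          rw [Finset.card_eq_zero.1 (by omega : T.card = 0), Finset.sum_empty] at hT
          linarith
      have h1 : 1 ≤ Real.exp (∑ i ∈ T, rowSum (adjMat A) i - t) :=
        Real.one_le_exp (by linarith)
      have h2 := Finset.single_le_sum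
        (f := fun T => Real.exp (∑ i ∈ T, rowSum (adjMat A) i - t))
        (fun _ _ => (Real.exp_pos _).le) hmem
      linarith

/-- fine identifiability for inhomogeneous random graphs,
with high probability. -/
theorem fine_identifiability_inhomo_whp :
    ∃ c > (0 : ℝ), ∃ c' > (0 : ℝ), ∃ C > (0 : ℝ), ∃ K > (0 : ℝ), ∃ N : ℕ,
      ∀ n ≥ N, ∀ (Q : Matrix (Fin n) (Fin n) ℝ) (R η dhat : ℝ),
        (∀ i j, Q i j = Q j i) → (∀ i, Q i i = 0) →
        (∀ i j, 0 ≤ Q i j ∧ Q i j ≤ 1) →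
        C ≤ dbar Q → 1 ≤ R → (∀ i j, Q i j ≤ R * dbar Q / n) →
        5 ≤ R * dbar Q →
        0 < η → η < 1 / Real.exp 1 → η * Real.log (1 / η) * R ≤ c →
        dbar Q / 2 ≤ dhat → dhat ≤ 3 * dbar Q / 2 →
        1 - (n : ℝ) ^ (-c' : ℝ) ≤
          erProb Q (fun A₀ =>
            ∀ A : Fin n → Fin n → Bool, IsGraph A →
              (nodeDist A A₀ : ℝ) ≤ η * n →
              ∀ (Y : Matrix (Fin n) (Fin n) ℝ) (z : Fin n → ℝ),
                P1 (adjMat A) (2 * η) Y z →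
                (∀ i, rowSum Y i ≤ 10 * Real.log (1 / η) * R * dhat) →
                |dbar Y - dbar Q| ≤
                  K * (Real.sqrt (dbar Q * Real.log n / n) +
                        η * Real.log (1 / η) * R * dbar Q)) := by
  refine ⟨1, one_pos, 1, one_pos, 1, one_pos, 118, by norm_num, 16, ?_⟩
  intro n hn Q R η dhat hsymm hdiag hQ hd hR1 hR hRd hη hη1 _ _ hdhat
  have hn0 : (0 : ℝ) < n := by exact_mod_cast (by omega : 0 < n)
  rw [Real.rpow_neg_one]
  refine (le_erProb_regular hn hsymm hdiag hQ hd hR hRd hη hη1).trans (erProb_mono hQ ?_)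
  rintro A₀ hA₀ ⟨hconc, hdeg⟩ A _ hdist Y z hP hrow
  obtain ⟨T, hTc, hT⟩ := exists_agreement_set hdist hP
  obtain ⟨-, -, hYs, hY01, -⟩ := hP
  have hL0 : 0 ≤ Real.log (1 / η) := Real.log_nonneg (by
    rw [le_div_iff₀ hη]
    have := hη1.trans_le ((div_le_one (Real.exp_pos 1)).2 (Real.one_le_exp zero_le_one))
    linarith)
  set L := Real.log (1 / η)
  have hA0 : ∀ i j, 0 ≤ adjMat A₀ i j := fun i j => by
    simp only [adjMat, Matrix.of_apply]
    split_ifs <;> norm_num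
  have hcmp := abs_sum_sub_sum_le Y (adjMat A₀) T hYs (by simp [adjMat, hA₀.1])
    (fun i j => (hY01 i j).1) hA0 hT
  have hYT : ∑ i ∈ T, rowSum Y i ≤ 45 * (η * L * n * (R * dbar Q)) := by
    have hb : 10 * L * R * dhat ≤ 15 * (L * (R * dbar Q)) := by
      have := mul_le_mul_of_nonneg_left hdhat (by positivity : 0 ≤ 10 * L * R)
      linarith
    calc ∑ i ∈ T, rowSum Y i ≤ ∑ i ∈ T, 15 * (L * (R * dbar Q)) :=
          Finset.sum_le_sum fun i _ => (hrow i).trans hb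
      _ = T.card * (15 * (L * (R * dbar Q))) := by simp
      _ ≤ 3 * η * n * (15 * (L * (R * dbar Q))) :=
          mul_le_mul_of_nonneg_right hTc (by positivity)
      _ = _ := by ring
  have hAT := hdeg T hTc
  have hsqrt : Real.sqrt (n * dbar Q * Real.log n) =
      n * Real.sqrt (dbar Q * Real.log n / n) := by
    rw [← Real.sqrt_sq hn0.le, ← Real.sqrt_mul (by positivity), Real.sqrt_sq hn0.le]
    congr 1
    field_simp
  rw [hsqrt] at hconc
  have htri := abs_sub_le (∑ i, rowSum Y i) (∑ i, rowSum (adjMat A₀) i) (∑ i, rowSum Q i)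
  have hdiff : dbar Y - dbar Q = (∑ i, rowSum Y i - ∑ i, rowSum Q i) / n := by
    simp only [dbar, rowSum, sub_div]
  rw [hdiff, abs_div, abs_of_pos hn0, div_le_iff₀ hn0]
  have hs0 : 0 ≤ n * Real.sqrt (dbar Q * Real.log n / n) := by positivity
  linarith

end EdgeDensity
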